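/- arXiv:1911.03521 — 3 statements merged into one kernel-verified Lean document; each statement's English description precedes it below -/
import Mathlib

section
/- Combination axiom for semiring potentials: let R be a commutative semiring, φ : Ω_S → R and ψ : Ω_T → R potentials on finite variable sets S and T with finite frames, and let U satisfy S ⊆ U ⊆ S∪T. Then (φ⊗ψ)↓U = φ ⊗ (ψ↓(U∩T)); that is, for all x ∈ Ω_U, Σ_{y∈Ω_{S∪T}, y|_U = x} φ(y|_S)·ψ(y|_T) = φ(x|_S) · Σ_{z∈Ω_T, z|_{U∩T} = x|_{U∩T}} ψ(z). -/
/-- Events (tuples of values) over a finite set `U` of variables. -/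
abbrev Event {X : Type*} (O : X → Type*) (U : Finset X) : Type _ :=
  ∀ m : U, O m.1

/-- Restriction (cartesian projection) of a tuple to a smaller set of variables. -/
def res {X : Type*} {O : X → Type*} {U U' : Finset X} (h : U ⊆ U')
    (y : Event O U') : Event O U :=
  fun m => y ⟨m.1, h m.2⟩

/-- Marginalization (projection) of a semiring-valued potential. -/
def marginal {X R : Type*} [AddCommMonoid R] [DecidableEq X] {O : X → Type*}
    [∀ m, Fintype (O m)] [∀ m, DecidableEq (O m)]
    {U U' : Finset X} (h : U ⊆ U') (d : Event O U' → R) : Event O U → R :=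
  fun x => ∑ y : Event O U', if res h y = x then d y else 0

/-- Combination of semiring potentials: `(φ ⊗ ψ)(y) = φ(y|_S) · ψ(y|_T)`. -/
def combine {X R : Type*} [Mul R] [DecidableEq X] {O : X → Type*}
    {S T : Finset X} (φ : Event O S → R) (ψ : Event O T → R) :
    Event O (S ∪ T) → R :=
  fun y => φ (res Finset.subset_union_left y) * ψ (res Finset.subset_union_right y)

/-- The tuple over `W` that agrees with `x` on `U` and with `z` on the rest of `W`. -/
def glue {X : Type*} [DecidableEq X] {O : X → Type*} {U T W : Finset X} (hW : W ⊆ U ∪ T)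
    (x : Event O U) (z : Event O T) : Event O W :=
  fun m => if h : m.1 ∈ U then x ⟨m.1, h⟩
    else z ⟨m.1, (Finset.mem_union.1 (hW m.2)).resolve_left h⟩

theorem res_glue_left {X : Type*} [DecidableEq X] {O : X → Type*} {U T W : Finset X}
    (hW : W ⊆ U ∪ T) (hU : U ⊆ W) (x : Event O U) (z : Event O T) :
    res hU (glue hW x z) = x := by
  funext m
  exact dif_pos m.2

theorem res_glue_right {X : Type*} [DecidableEq X] {O : X → Type*} {U T W : Finset X}
    (hW : W ⊆ U ∪ T) (hT : T ⊆ W) {x : Event O U} {z : Event O T}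
    (hxz : res (Finset.inter_subset_right (s₁ := U)) z = res Finset.inter_subset_left x) :
    res hT (glue hW x z) = z := by
  funext m
  by_cases h : m.1 ∈ U
  · exact (dif_pos h).trans (congrFun hxz ⟨m.1, Finset.mem_inter.2 ⟨h, m.2⟩⟩).symm
  · exact dif_neg h

theorem glue_res {X : Type*} [DecidableEq X] {O : X → Type*} {U T W : Finset X}
    (hW : W ⊆ U ∪ T) (hU : U ⊆ W) (hT : T ⊆ W) (y : Event O W) :
    glue hW (res hU y) (res hT y) = y := by
  funext m
  by_cases h : m.1 ∈ U
  · exact dif_pos h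
  · exact dif_neg h

/-- Combination axiom for semiring potentials: for
`S ⊆ U ⊆ S ∪ T`, `(φ ⊗ ψ)↓U = φ ⊗ (ψ↓(U ∩ T))`, i.e. pointwise
`((φ⊗ψ)↓U)(x) = φ(x|_S) · (ψ↓(U∩T))(x|_{U∩T})`. -/
theorem marginal_combine {V R : Type*} [DecidableEq V] [CommSemiring R]
    (Ω : V → Type*) [∀ v, Fintype (Ω v)] [∀ v, DecidableEq (Ω v)]
    {S T U : Finset V} (hSU : S ⊆ U) (hU : U ⊆ S ∪ T)
    (φ : Event Ω S → R) (ψ : Event Ω T → R) :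
    marginal hU (combine φ ψ) = fun x : Event Ω U =>
      φ (res hSU x) *
        marginal (Finset.inter_subset_right (s₁ := U) (s₂ := T)) ψ
          (res (Finset.inter_subset_left (s₁ := U) (s₂ := T)) x) := by
  have hW : S ∪ T ⊆ U ∪ T := Finset.union_subset_union_left hSU
  have hT : T ⊆ S ∪ T := Finset.subset_union_right
  funext x
  simp only [marginal, combine, ← Finset.sum_filter, Finset.mul_sum]
  refine Finset.sum_bij' (fun y _ => res hT y) (fun z _ => glue hW x z) ?_ ?_ ?_ ?_ ?_
  · intro y hy
    obtain rfl := (Finset.mem_filter.1 hy).2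
    exact Finset.mem_filter.2 ⟨Finset.mem_univ _, rfl⟩
  · intro z _
    exact Finset.mem_filter.2 ⟨Finset.mem_univ _, res_glue_left hW hU x z⟩
  · intro y hy
    obtain rfl := (Finset.mem_filter.1 hy).2
    exact glue_res hW hU hT y
  · intro z hz
    exact res_glue_right hW hT (Finset.mem_filter.1 hz).2
  · intro y hy
    obtain rfl := (Finset.mem_filter.1 hy).2
    rfl
end

section
/- Proposition (truth valuations in adjoint valuation algebras): let Φ be an adjoint ordered valuation algebra over a set V of variables, let K = {φ₁,…,φ_n} ⊆ Φ be a knowledgebase, X = ⋃_{i=1}^n d(φ_i), and γ = φ₁⊗⋯⊗φ_n. Then K agrees globally (there exists δ ∈ Φ_X with δ↓d(φ_i) = φ_i for all i) if and only if γ↓d(φ_i) = φ_i for all i. Moreover, in that case γ is the most informative truth valuation: every δ ∈ Φ_X with δ↓d(φ_i) = φ_i for all i satisfies δ ⪯ γ. -/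
/-- An adjoint ordered valuation algebra over a set `V` of variables:
a valuation algebra (axioms (A1)–(A6)) with null elements, a partial order
`⪯` compatible with labelling, infima on each `Φ_S` with `inf Φ_S = z S`,
monotone combination and projection, and such that combination
`⊗ : Φ_S × Φ_T → Φ_{S∪T}` is right adjoint to the pairing `⟨↓S, ↓T⟩`. -/
structure AdjointOrderedValuationAlgebra (V : Type*) [DecidableEq V] where
  carrier : Type*
  lab : carrier → Finset V
  proj : carrier → Finset V → carrier
  comb : carrier → carrier → carrier
  le : carrier → carrier → Prop
  z : Finset V → carrier
  /-- (A1) -/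
  comb_assoc : ∀ a b c, comb (comb a b) c = comb a (comb b c)
  /-- (A1) -/
  comb_comm : ∀ a b, comb a b = comb b a
  /-- (A2) -/
  lab_proj : ∀ φ S, S ⊆ lab φ → lab (proj φ S) = S
  /-- (A3) -/
  proj_trans : ∀ φ S T, S ⊆ T → T ⊆ lab φ → proj (proj φ T) S = proj φ S
  /-- (A4) -/
  proj_lab : ∀ φ, proj φ (lab φ) = φ
  /-- (A5) -/
  lab_comb : ∀ φ ψ, lab (comb φ ψ) = lab φ ∪ lab ψ
  /-- (A6) -/
  comb_proj : ∀ φ ψ U, lab φ ⊆ U → U ⊆ lab φ ∪ lab ψ →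
    proj (comb φ ψ) U = comb φ (proj ψ (U ∩ lab ψ))
  /-- null elements -/
  lab_z : ∀ S, lab (z S) = S
  comb_z : ∀ S φ, lab φ = S → comb φ (z S) = z S
  proj_z_iff : ∀ S T φ, S ⊆ T → lab φ = T → (proj φ S = z S ↔ φ = z T)
  /-- `⪯` is a partial order -/
  le_refl : ∀ φ, le φ φ
  le_trans : ∀ φ ψ χ, le φ ψ → le ψ χ → le φ χ
  le_antisymm : ∀ φ ψ, le φ ψ → le ψ φ → φ = ψ
  /-- (A10) comparable valuations have equal domains -/
  le_lab : ∀ φ ψ, le φ ψ → lab φ = lab ψ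
  /-- (A10) every subset of `Φ_S` has an infimum -/
  inf_exists : ∀ (S : Finset V) (Ψ : Set carrier), (∀ ψ ∈ Ψ, lab ψ = S) →
    ∃ ℓ, lab ℓ = S ∧ (∀ ψ ∈ Ψ, le ℓ ψ) ∧
      ∀ m, lab m = S → (∀ ψ ∈ Ψ, le m ψ) → le m ℓ
  /-- (A11) `inf Φ_S = z S` -/
  z_le : ∀ S φ, lab φ = S → le (z S) φ
  /-- (A12) monotonicity of combination -/
  comb_mono : ∀ a b c d, le a b → le c d → le (comb a c) (comb b d)
  /-- (A13) monotonicity of projection -/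
  proj_mono : ∀ φ ψ S, le φ ψ → S ⊆ lab φ → le (proj φ S) (proj ψ S)
  /-- adjointness (unit): `γ ⪯ (γ↓S) ⊗ (γ↓T)` for `γ ∈ Φ_{S∪T}` -/
  adjoint_unit : ∀ γ S T, lab γ = S ∪ T → le γ (comb (proj γ S) (proj γ T))
  /-- adjointness (counit): `(φ ⊗ ψ)↓d(φ) ⪯ φ` -/
  adjoint_counit_left : ∀ φ ψ, le (proj (comb φ ψ) (lab φ)) φ
  /-- adjointness (counit): `(φ ⊗ ψ)↓d(ψ) ⪯ ψ` -/
  adjoint_counit_right : ∀ φ ψ, le (proj (comb φ ψ) (lab ψ)) ψ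

/-- The combination `φ 0 ⊗ ⋯ ⊗ φ n` of a finite family of valuations. -/
def combFam {V : Type*} [DecidableEq V] (A : AdjointOrderedValuationAlgebra V) :
    ∀ {n : ℕ}, (Fin (n + 1) → A.carrier) → A.carrier
  | 0, φ => φ 0
  | n + 1, φ => A.comb (combFam A fun i => φ i.castSucc) (φ (Fin.last (n + 1)))

theorem lab_combFam {V : Type*} [DecidableEq V] (A : AdjointOrderedValuationAlgebra V) {n : ℕ}
    (φ : Fin (n + 1) → A.carrier) :
    A.lab (combFam A φ) = Finset.univ.biUnion fun i => A.lab (φ i) := by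
  induction n with
  | zero => ext x; simp [combFam]
  | succ n ih =>
    ext x
    simp [combFam, A.lab_comb, ih, Fin.exists_fin_succ']

theorem lab_subset_lab_combFam {V : Type*} [DecidableEq V]
    (A : AdjointOrderedValuationAlgebra V) {n : ℕ} (φ : Fin (n + 1) → A.carrier)
    (i : Fin (n + 1)) : A.lab (φ i) ⊆ A.lab (combFam A φ) := by
  rw [lab_combFam]
  exact Finset.subset_biUnion_of_mem (fun i => A.lab (φ i)) (Finset.mem_univ i)

/-- Projecting a combination to the domain of a factor yields at most that factor. -/
theorem proj_combFam_le {V : Type*} [DecidableEq V] (A : AdjointOrderedValuationAlgebra V)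
    {n : ℕ} (φ : Fin (n + 1) → A.carrier) (i : Fin (n + 1)) :
    A.le (A.proj (combFam A φ) (A.lab (φ i))) (φ i) := by
  induction n with
  | zero =>
    obtain rfl : i = 0 := Fin.fin_one_eq_zero i
    simpa [combFam, A.proj_lab] using A.le_refl (φ 0)
  | succ n ih =>
    induction i using Fin.lastCases with
    | last => exact A.adjoint_counit_right _ _
    | cast i =>
      set ψ := combFam A fun j => φ j.castSucc
      have hi : A.lab (φ i.castSucc) ⊆ A.lab ψ :=
        lab_subset_lab_combFam A (fun j => φ j.castSucc) i
      have hψ : A.lab ψ ⊆ A.lab (A.comb ψ (φ (Fin.last (n + 1)))) := by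
        rw [A.lab_comb]
        exact Finset.subset_union_left
      have h := A.proj_mono _ _ (A.lab (φ i.castSucc))
        (A.adjoint_counit_left ψ (φ (Fin.last (n + 1)))) (by rwa [A.lab_proj _ _ hψ])
      rw [A.proj_trans _ _ _ hi hψ] at h
      exact A.le_trans _ _ _ h (ih (fun j => φ j.castSucc) i)

/-- Every valuation projecting onto all members of a family, with domain the union of their
domains, lies below their combination. -/
theorem le_combFam {V : Type*} [DecidableEq V] (A : AdjointOrderedValuationAlgebra V)
    {n : ℕ} (φ : Fin (n + 1) → A.carrier) (δ : A.carrier)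
    (hlab : A.lab δ = A.lab (combFam A φ))
    (hproj : ∀ i, A.proj δ (A.lab (φ i)) = φ i) : A.le δ (combFam A φ) := by
  induction n generalizing δ with
  | zero =>
    have h : δ = φ 0 := by rw [← hproj 0, show A.lab (φ 0) = A.lab δ from hlab.symm, A.proj_lab]
    exact h ▸ A.le_refl _
  | succ n ih =>
    set ψ := combFam A fun j => φ j.castSucc
    have hlab' : A.lab δ = A.lab ψ ∪ A.lab (φ (Fin.last (n + 1))) :=
      hlab.trans (A.lab_comb _ _)
    have hsub : A.lab ψ ⊆ A.lab δ := hlab' ▸ Finset.subset_union_left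
    have hle : A.le (A.proj δ (A.lab ψ)) ψ :=
      ih (fun j => φ j.castSucc) _ (A.lab_proj _ _ hsub) fun j =>
        (A.proj_trans _ _ _ (lab_subset_lab_combFam A (fun j => φ j.castSucc) j) hsub).trans
          (hproj j.castSucc)
    have h := A.adjoint_unit _ _ _ hlab'
    rw [hproj] at h
    exact A.le_trans _ _ _ h (A.comb_mono _ _ _ _ hle (A.le_refl _))

/-- **Statement 7.** Truth valuations in adjoint ordered valuation algebras:
a knowledgebase `K = {φ 0, …, φ n}` agrees globally (some `δ` with
`d(δ) = X = ⋃ i, d(φ i)` projects onto every `φ i`) iff the combination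
`γ = φ 0 ⊗ ⋯ ⊗ φ n` projects onto every `φ i`; moreover in that case `γ` is
the most informative truth valuation: every truth valuation `δ` satisfies
`δ ⪯ γ`. -/
theorem truth_valuation {V : Type*} [DecidableEq V]
    (A : AdjointOrderedValuationAlgebra V) {n : ℕ}
    (φ : Fin (n + 1) → A.carrier) :
    ((∃ δ, A.lab δ = (Finset.univ.biUnion fun i => A.lab (φ i)) ∧
        ∀ i, A.proj δ (A.lab (φ i)) = φ i)
      ↔ ∀ i, A.proj (combFam A φ) (A.lab (φ i)) = φ i)
    ∧ ∀ δ, A.lab δ = (Finset.univ.biUnion fun i => A.lab (φ i)) →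
        (∀ i, A.proj δ (A.lab (φ i)) = φ i) → A.le δ (combFam A φ) := by
  have hle : ∀ δ, A.lab δ = (Finset.univ.biUnion fun i => A.lab (φ i)) →
      (∀ i, A.proj δ (A.lab (φ i)) = φ i) → A.le δ (combFam A φ) := fun δ hlab hproj =>
    le_combFam A φ δ (hlab.trans (lab_combFam A φ).symm) hproj
  refine ⟨⟨?_, fun h => ⟨combFam A φ, lab_combFam A φ, h⟩⟩, hle⟩
  rintro ⟨δ, hlab, hproj⟩ i
  refine A.le_antisymm _ _ (proj_combFam_le A φ i) ?_
  have h := A.proj_mono _ _ (A.lab (φ i)) (hle δ hlab hproj)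
    (hlab ▸ Finset.subset_biUnion_of_mem (fun i => A.lab (φ i)) (Finset.mem_univ i))
  rwa [hproj] at h
end

section
/- Proposition (global disagreement equals logical contextuality): let S be a possibilistic empirical model on a measurement scenario ⟨X, M, (O_m)⟩. Then there is no subset G ⊆ E(X) with { g|_C : g ∈ G } = S(C) for every C ∈ M (i.e. the knowledgebase {S(C)}_{C∈M} of relations disagrees globally) if and only if S is logically contextual, i.e. there exist C₀ ∈ M and s ∈ S(C₀) such that no g ∈ S(X) satisfies g|_{C₀} = s. -/
/-- A possibilistic empirical model on the measurement scenario
`⟨X, M, (O m)⟩`: a subpresheaf of the sheaf of events which is nonempty on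
contexts, flasque beneath the cover, and glues compatible families on the
cover to global sections. -/
structure PossibilisticModel (X : Type*) [DecidableEq X] [Fintype X]
    (O : X → Type*) (M : Finset (Finset X)) where
  /-- the sets of possible sections -/
  sections : (U : Finset X) → Set (Event O U)
  /-- subpresheaf: restrictions of sections are sections -/
  res_mem : ∀ {U U' : Finset X} (h : U ⊆ U'), ∀ s ∈ sections U', res h s ∈ sections U
  /-- (1) nonempty on every context -/
  nonempty_context : ∀ C ∈ M, (sections C).Nonempty
  /-- (2) flasque beneath the cover -/
  flasque : ∀ {U U' C : Finset X} (h : U ⊆ U'), U' ⊆ C → C ∈ M →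
    ∀ x ∈ sections U, ∃ y ∈ sections U', res h y = x
  /-- (3) compatible families on the cover glue to global sections -/
  glue : ∀ s : (C : Finset X) → Event O C,
    (∀ C ∈ M, s C ∈ sections C) →
    (∀ C ∈ M, ∀ C' ∈ M,
      res (Finset.inter_subset_left (s₁ := C) (s₂ := C')) (s C)
        = res (Finset.inter_subset_right (s₁ := C) (s₂ := C')) (s C')) →
    ∃ g ∈ sections Finset.univ, ∀ C ∈ M, res (Finset.subset_univ C) g = s C


/-- **Statement 9.** Global disagreement equals logical contextuality: there
is no set `G ⊆ E(X)` of global events whose projection to every context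
`C ∈ M` is exactly `S(C)` iff the model is logically contextual, i.e. some
possible local section `s ∈ S(C₀)` extends to no global section
`g ∈ S(X)`. -/
theorem global_disagreement_iff_logically_contextual
    {X : Type*} [DecidableEq X] [Fintype X]
    (O : X → Type*) [∀ m, Fintype (O m)] [∀ m, Nonempty (O m)]
    (M : Finset (Finset X)) (hM : M.Nonempty)
    (hcover : ∀ m : X, ∃ C ∈ M, m ∈ C)
    (P : PossibilisticModel X O M) :
    (¬ ∃ G : Set (Event O (Finset.univ : Finset X)),
        ∀ C ∈ M, res (Finset.subset_univ C) '' G = P.sections C)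
      ↔ ∃ C₀ ∈ M, ∃ s ∈ P.sections C₀,
          ¬ ∃ g ∈ P.sections Finset.univ, res (Finset.subset_univ C₀) g = s := by
  rw [not_iff_comm]
  push Not
  constructor
  · intro h
    refine ⟨P.sections Finset.univ, fun C hC => Set.Subset.antisymm ?_ fun s hs => h C hC s hs⟩
    rintro _ ⟨g, hg, rfl⟩
    exact P.res_mem _ g hg
  · rintro ⟨G, hG⟩ C hC s hs
    obtain ⟨g, hg, rfl⟩ := (hG C hC).symm.subset hs
    obtain ⟨g', hg', h⟩ := P.glue (fun C => res (Finset.subset_univ C) g)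
      (fun D hD => (hG D hD).subset ⟨g, hg, rfl⟩) (fun _ _ _ _ => rfl)
    exact ⟨g', hg', h C hC⟩
end
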